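/- Let T₁ and T₂ be full binary trees with the same number of leaves, and suppose that T₁ contains a subtree S₁ and T₂ contains a subtree S₂ such that S₁ and S₂ span the same interval of leaf positions and are attached at the same position in both trees (so that replacing each S_i by a single leaf yields trees Q₁ and Q₂ on the same smaller leaf set, and S₁, S₂ are full binary trees on the same leaf set). Then the rotation distance decomposes as a sum: d_R(T₁, T₂) = d_R(S₁, S₂) + d_R(Q₁, Q₂). -/

import Mathlib

/-- Full binary trees: ordered rooted trees in which every internal node has
exactly two children.  A `leaf` has one leaf; `node l r` has the leaves of `l`
followed by the leaves of `r` in left-to-right order. -/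
inductive BT : Type
  | leaf : BT
  | node : BT → BT → BT
deriving DecidableEq

namespace BT

/-- The number of leaves (the size) of a full binary tree. -/
def numLeaves : BT → ℕ
  | leaf => 1
  | node l r => numLeaves l + numLeaves r

/-- A single rotation (left or right) performed at some node of the tree.
A right rotation replaces a subtree `(A ∧ B) ∧ C` by `A ∧ (B ∧ C)`; a left
rotation is the inverse.  The left-to-right order of leaves is unchanged. -/
inductive Rot : BT → BT → Prop
  | rotR (a b c : BT) : Rot (node (node a b) c) (node a (node b c))
  | rotL (a b c : BT) : Rot (node a (node b c)) (node (node a b) c)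
  | congL {l l' : BT} (r : BT) : Rot l l' → Rot (node l r) (node l' r)
  | congR (l : BT) {r r' : BT} : Rot r r' → Rot (node l r) (node l r')

/-- `RotSeq n t u` : there is a sequence of exactly `n` rotations
transforming `t` into `u`. -/
inductive RotSeq : ℕ → BT → BT → Prop
  | refl (t : BT) : RotSeq 0 t t
  | step {n : ℕ} {t u v : BT} : Rot t u → RotSeq n u v → RotSeq (n + 1) t v

/-- The rotation distance between two trees: the least number of rotations
needed to transform one into the other. -/
noncomputable def rotDist (t u : BT) : ℕ := sInf {n | RotSeq n t u}

/-- `OccursAt S T p` : the subtree of `T` at the path `p` (a list of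
directions, `false` = left child, `true` = right child) is exactly `S`. -/
inductive OccursAt : BT → BT → List Bool → Prop
  | here (T : BT) : OccursAt T T []
  | left {S l : BT} {p : List Bool} (r : BT) :
      OccursAt S l p → OccursAt S (node l r) (false :: p)
  | right (l : BT) {S r : BT} {p : List Bool} :
      OccursAt S r p → OccursAt S (node l r) (true :: p)

/-- Replace the subtree at path `p` of `T` by `R`. -/
def replaceAt : BT → List Bool → BT → BT
  | _, [], R => R
  | leaf, _ :: _, _ => leaf
  | node l r, false :: p, R => node (replaceAt l p R) r
  | node l r, true :: p, R => node l (replaceAt r p R)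

/-- The number of leaves of `T` lying strictly to the left of the subtree at
path `p`; together with the size of that subtree this determines the interval
of leaf positions it spans. -/
def leavesBefore : BT → List Bool → ℕ
  | _, [] => 0
  | leaf, _ :: _ => 0
  | node l _, false :: p => leavesBefore l p
  | node l r, true :: p => numLeaves l + leavesBefore r p

/-- Build a chain of pendant subtrees above the tree `rest`.  Each entry
`(b, t)` attaches the pendant subtree `t` as the left child of its parent when
`b = true` and as the right child when `b = false`; the parent of each pendant
subtree is the grandparent of the next one, and depths increase along the
list. -/
def buildChain : List (Bool × BT) → BT → BT
  | [], rest => rest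
  | (true, t) :: L, rest => node t (buildChain L rest)
  | (false, t) :: L, rest => node (buildChain L rest) t

/-- The number of leaves lying strictly to the left of the `j`-th pendant
subtree inside the chain `buildChain L rest` (relative to the root of the
chain). -/
def pendantOffset : List (Bool × BT) → BT → ℕ → ℕ
  | [], _, _ => 0
  | (b, _) :: L, rest, 0 => if b then 0 else numLeaves (buildChain L rest)
  | (b, t) :: L, rest, j + 1 =>
      (if b then numLeaves t else 0) + pendantOffset L rest j

/-- `IsCommonChain T₁ T₂ p₁ p₂ bs ts R₁ R₂` : the pendant subtrees `ts` form a
common chain of `T₁` and `T₂`, rooted at path `p₁` in `T₁` (with the `j`-th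
pendant subtree a left child of its parent iff `bs j = true`) and at path `p₂`
in `T₂` (with all the sides reversed), with the trees `R₁`, `R₂` hanging below
the chain, and with each pendant subtree occupying the same interval of leaf
positions in `T₁` and in `T₂`. -/
def IsCommonChain (T₁ T₂ : BT) (p₁ p₂ : List Bool) (bs : List Bool)
    (ts : List BT) (R₁ R₂ : BT) : Prop :=
  bs.length = ts.length ∧
  OccursAt (buildChain (bs.zip ts) R₁) T₁ p₁ ∧
  OccursAt (buildChain ((bs.map fun b => !b).zip ts) R₂) T₂ p₂ ∧
  ∀ j < ts.length,
    leavesBefore T₁ p₁ + pendantOffset (bs.zip ts) R₁ j =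
      leavesBefore T₂ p₂ + pendantOffset ((bs.map fun b => !b).zip ts) R₂ j

/-- One application of the subtree reduction rule to a pair of trees: a common
subtree `S` with at least two leaves, occurring at the same leaf positions in
both trees, is replaced in each tree by a single placeholder leaf. -/
def SubtreeStep (P Q : BT × BT) : Prop :=
  ∃ (S : BT) (p₁ p₂ : List Bool),
    2 ≤ numLeaves S ∧
    OccursAt S P.1 p₁ ∧ OccursAt S P.2 p₂ ∧
    leavesBefore P.1 p₁ = leavesBefore P.2 p₂ ∧
    Q.1 = replaceAt P.1 p₁ leaf ∧ Q.2 = replaceAt P.2 p₂ leaf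

/-- One application of the common chain reduction rule to a pair of trees: a
common chain of more than three pendant subtrees is replaced in both trees by
a common chain of three pendant leaves, ordered the same way in both trees. -/
def ChainStep (P Q : BT × BT) : Prop :=
  ∃ (p₁ p₂ bs cs : List Bool) (ts : List BT) (R₁ R₂ : BT),
    4 ≤ ts.length ∧ cs.length = 3 ∧
    IsCommonChain P.1 P.2 p₁ p₂ bs ts R₁ R₂ ∧
    Q.1 = replaceAt P.1 p₁ (buildChain (cs.zip [leaf, leaf, leaf]) R₁) ∧
    Q.2 = replaceAt P.2 p₂
      (buildChain ((cs.map fun b => !b).zip [leaf, leaf, leaf]) R₂) ∧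
    IsCommonChain Q.1 Q.2 p₁ p₂ cs [leaf, leaf, leaf] R₁ R₂

/-- One application of either reduction rule. -/
def RedStep (P Q : BT × BT) : Prop := SubtreeStep P Q ∨ ChainStep P Q

/-- A pair of trees is fully reduced when neither reduction rule applies. -/
def Reduced (P : BT × BT) : Prop := ∀ Q, ¬ RedStep P Q

/-- `ExhaustiveReduction P Q` : the pair `Q` is obtained from the pair `P` by
applying the subtree reduction rule and the common chain reduction rule
exhaustively, i.e. repeatedly until neither rule applies. -/
def ExhaustiveReduction (P Q : BT × BT) : Prop :=
  Relation.ReflTransGen RedStep P Q ∧ Reduced Q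

end BT

namespace BT

theorem Rot.symm {t u : BT} (h : Rot t u) : Rot u t := by
  induction h with
  | rotR a b c => exact .rotL a b c
  | rotL a b c => exact .rotR a b c
  | congL r _ ih => exact .congL r ih
  | congR l _ ih => exact .congR l ih

theorem Rot.numLeaves_eq {t u : BT} (h : Rot t u) : t.numLeaves = u.numLeaves := by
  induction h <;> simp_all [numLeaves, add_assoc]

theorem RotSeq.trans {m n : ℕ} {t u v : BT} (h : RotSeq m t u) (h' : RotSeq n u v) :
    RotSeq (m + n) t v := by
  induction h with
  | refl t => simpa using h'
  | step hr _ ih =>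
    rw [Nat.add_right_comm]
    exact .step hr (ih h')

theorem RotSeq.symm {n : ℕ} {t u : BT} (h : RotSeq n t u) : RotSeq n u t := by
  induction h with
  | refl t => exact .refl t
  | step hr _ ih => exact ih.trans (.step hr.symm (.refl _))

theorem RotSeq.congL {n : ℕ} {l l' : BT} (r : BT) (h : RotSeq n l l') :
    RotSeq n (node l r) (node l' r) := by
  induction h with
  | refl t => exact .refl _
  | step hr _ ih => exact .step (.congL r hr) ih

theorem RotSeq.congR {n : ℕ} (l : BT) {r r' : BT} (h : RotSeq n r r') :
    RotSeq n (node l r) (node l r') := by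
  induction h with
  | refl t => exact .refl _
  | step hr _ ih => exact .step (.congR l hr) ih

theorem RotSeq.rotDist_le {n : ℕ} {t u : BT} (h : RotSeq n t u) : rotDist t u ≤ n :=
  Nat.sInf_le h

/-- The right comb with `n + 1` leaves. -/
def comb : ℕ → BT
  | 0 => leaf
  | n + 1 => node leaf (comb n)

theorem exists_rotSeq_node_comb (l : BT) : ∀ (r : BT) (m : ℕ), (∃ n, RotSeq n r (comb m)) →
    ∃ n, RotSeq n (node l r) (comb (l.numLeaves + m)) := by
  induction l with
  | leaf =>
    rintro r m ⟨n, h⟩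
    rw [numLeaves, Nat.add_comm]
    exact ⟨n, h.congR leaf⟩
  | node a b iha ihb =>
    intro r m h
    obtain ⟨n, hn⟩ := iha _ _ (ihb r m h)
    rw [numLeaves, Nat.add_assoc]
    exact ⟨n + 1, .step (.rotR a b r) hn⟩

theorem exists_rotSeq_comb (t : BT) :
    ∃ m, t.numLeaves = m + 1 ∧ ∃ n, RotSeq n t (comb m) := by
  induction t with
  | leaf => exact ⟨0, rfl, 0, .refl _⟩
  | node l r _ ihr =>
    obtain ⟨m, hm, h⟩ := ihr
    exact ⟨l.numLeaves + m, by rw [numLeaves, hm, Nat.add_assoc],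
      exists_rotSeq_node_comb l r m h⟩

/-- Any two trees of the same size are connected by rotations. -/
theorem exists_rotSeq {t u : BT} (h : t.numLeaves = u.numLeaves) : ∃ n, RotSeq n t u := by
  obtain ⟨m, hm, n, hn⟩ := exists_rotSeq_comb t
  obtain ⟨m', hm', n', hn'⟩ := exists_rotSeq_comb u
  obtain rfl : m = m' := by omega
  exact ⟨_, hn.trans hn'.symm⟩

theorem rotSeq_rotDist {t u : BT} (h : t.numLeaves = u.numLeaves) :
    RotSeq (rotDist t u) t u :=
  Nat.sInf_mem (exists_rotSeq h)

theorem OccursAt.leavesBefore_add_le {S T : BT} {p : List Bool} (h : OccursAt S T p) :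
    leavesBefore T p + S.numLeaves ≤ T.numLeaves := by
  induction h <;> simp only [leavesBefore, numLeaves] <;> omega

theorem OccursAt.numLeaves_replaceAt {S T : BT} {p : List Bool} (h : OccursAt S T p) (R : BT) :
    (replaceAt T p R).numLeaves + S.numLeaves = T.numLeaves + R.numLeaves := by
  induction h <;> simp only [replaceAt, numLeaves] <;> omega

theorem OccursAt.replaceAt_self {S T : BT} {p : List Bool} (h : OccursAt S T p) :
    replaceAt T p S = T := by
  induction h <;> simp_all [replaceAt]

theorem OccursAt.rotSeq_replaceAt {S T : BT} {p : List Bool} (h : OccursAt S T p)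
    {n : ℕ} {R R' : BT} (hR : RotSeq n R R') :
    RotSeq n (replaceAt T p R) (replaceAt T p R') := by
  induction h with
  | here T => simpa only [replaceAt] using hR
  | left r _ ih => exact ih.congL r
  | right l _ ih => exact ih.congR l

/-- Join two possibly empty trees, contracting the root if one of them is empty. -/
def join : Option BT → Option BT → Option BT
  | none, u => u
  | some t, none => some t
  | some t, some u => some (node t u)

/-- The tree induced by `t` on those leaves whose position, counted from `o`, satisfies `P`. -/
def restrict (P : ℕ → Prop) [DecidablePred P] : ℕ → BT → Option BT
  | o, leaf => if P o then some leaf else none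
  | o, node l r => join (restrict P o l) (restrict P (o + l.numLeaves) r)

section restrict

variable (P : ℕ → Prop) [DecidablePred P]

theorem restrict_eq_none (t : BT) : ∀ o : ℕ,
    (∀ i, o ≤ i → i < o + t.numLeaves → ¬ P i) → restrict P o t = none := by
  induction t with
  | leaf =>
    intro o h
    simp [restrict, h o le_rfl (by simp [numLeaves])]
  | node l r ihl ihr =>
    intro o h
    simp only [numLeaves] at h
    rw [restrict, ihl o fun i _ _ => h i (by omega) (by omega),
      ihr _ fun i _ _ => h i (by omega) (by omega), join]

theorem exists_of_restrict_ne_none {t : BT} {o : ℕ} (h : restrict P o t ≠ none) :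
    ∃ i, o ≤ i ∧ i < o + t.numLeaves ∧ P i := by
  by_contra! hP
  exact h (restrict_eq_none P t o hP)

theorem restrict_eq_some_self (t : BT) : ∀ o : ℕ,
    (∀ i, o ≤ i → i < o + t.numLeaves → P i) → restrict P o t = some t := by
  induction t with
  | leaf =>
    intro o h
    simp [restrict, h o le_rfl (by simp [numLeaves])]
  | node l r ihl ihr =>
    intro o h
    simp only [numLeaves] at h
    rw [restrict, ihl o fun i _ _ => h i (by omega) (by omega),
      ihr _ fun i _ _ => h i (by omega) (by omega), join]

theorem numLeaves_pos (t : BT) : 0 < t.numLeaves := by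
  induction t <;> simp only [numLeaves] <;> omega

theorem restrict_eq_some_leaf (t : BT) : ∀ o : ℕ,
    (∀ i, o ≤ i → i < o + t.numLeaves → (P i ↔ i = o)) → restrict P o t = some leaf := by
  induction t with
  | leaf =>
    intro o h
    simp [restrict, h o le_rfl (by simp [numLeaves])]
  | node l r ihl _ =>
    intro o h
    have hl := numLeaves_pos l
    simp only [numLeaves] at h
    rw [restrict, ihl o fun i _ _ => h i (by omega) (by omega),
      restrict_eq_none P r _ fun i _ _ => by rw [h i (by omega) (by omega)]; omega, join]

end restrict

theorem OccursAt.restrict_inside {S T : BT} {p : List Bool} (h : OccursAt S T p) {a : ℕ} :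
    ∀ o, a = o + leavesBefore T p →
      restrict (fun i => a ≤ i ∧ i < a + S.numLeaves) o T = some S := by
  induction h with
  | here T =>
    intro o ha
    simp only [leavesBefore] at ha
    exact restrict_eq_some_self _ _ _ fun i _ _ => by omega
  | left r hS ih =>
    intro o ha
    simp only [leavesBefore] at ha
    have := hS.leavesBefore_add_le
    rw [restrict, ih o ha, restrict_eq_none _ r _ fun i _ _ => by omega, join]
  | right l hS ih =>
    intro o ha
    simp only [leavesBefore] at ha
    rw [restrict, ih _ (by omega), restrict_eq_none _ l _ fun i _ _ => by omega, join]

theorem OccursAt.restrict_outside {S T : BT} {p : List Bool} (h : OccursAt S T p) {a : ℕ} :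
    ∀ o, a = o + leavesBefore T p →
      restrict (fun i => i ≤ a ∨ a + S.numLeaves ≤ i) o T = some (replaceAt T p leaf) := by
  induction h with
  | here T =>
    intro o ha
    simp only [leavesBefore] at ha
    rw [replaceAt]
    exact restrict_eq_some_leaf _ _ _ fun i _ _ => by omega
  | left r hS ih =>
    intro o ha
    simp only [leavesBefore] at ha
    have := hS.leavesBefore_add_le
    rw [restrict, ih o ha, restrict_eq_some_self _ r _ fun i _ _ => by omega, join, replaceAt]
  | right l hS ih =>
    intro o ha
    simp only [leavesBefore] at ha
    rw [restrict, ih _ (by omega), restrict_eq_some_self _ l _ fun i _ _ => by omega, join,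
      replaceAt]

/-- Two possibly empty trees that are equal or differ by one rotation. -/
def RotOrEq (x y : Option BT) : Prop :=
  x = y ∨ ∃ t u, x = some t ∧ y = some u ∧ Rot t u

theorem RotOrEq.join_left {x y : Option BT} (z : Option BT) (h : RotOrEq x y) :
    RotOrEq (join x z) (join y z) := by
  rcases h with rfl | ⟨t, u, rfl, rfl, h⟩
  · exact .inl rfl
  · cases z with
    | none => exact .inr ⟨t, u, rfl, rfl, h⟩
    | some r => exact .inr ⟨_, _, rfl, rfl, .congL r h⟩

theorem RotOrEq.join_right {x y : Option BT} (z : Option BT) (h : RotOrEq x y) :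
    RotOrEq (join z x) (join z y) := by
  rcases h with rfl | ⟨t, u, rfl, rfl, h⟩
  · exact .inl rfl
  · cases z with
    | none => exact .inr ⟨t, u, rfl, rfl, h⟩
    | some l => exact .inr ⟨_, _, rfl, rfl, .congR l h⟩

theorem RotOrEq.symm {x y : Option BT} (h : RotOrEq x y) : RotOrEq y x := by
  rcases h with h | ⟨t, u, ht, hu, h⟩
  · exact .inl h.symm
  · exact .inr ⟨u, t, hu, ht, h.symm⟩

theorem rotOrEq_join_assoc (x y z : Option BT) :
    RotOrEq (join (join x y) z) (join x (join y z)) := by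
  cases x <;> cases y <;> cases z <;> first
    | exact .inl rfl
    | exact .inr ⟨_, _, rfl, rfl, .rotR _ _ _⟩

theorem join_assoc_of_eq_none {x y z : Option BT} (h : x = none ∨ y = none ∨ z = none) :
    join (join x y) z = join x (join y z) := by
  rcases h with rfl | rfl | rfl
  · rfl
  · cases x <;> rfl
  · cases x <;> cases y <;> rfl

theorem Rot.rotOrEq_restrict (P : ℕ → Prop) [DecidablePred P] {t u : BT} (h : Rot t u) :
    ∀ o, RotOrEq (restrict P o t) (restrict P o u) := by
  induction h with
  | rotR a b c =>
    intro o
    simp only [restrict, numLeaves, ← Nat.add_assoc]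
    exact rotOrEq_join_assoc _ _ _
  | rotL a b c =>
    intro o
    simp only [restrict, numLeaves, ← Nat.add_assoc]
    exact (rotOrEq_join_assoc _ _ _).symm
  | congL r h ih =>
    intro o
    rw [restrict, restrict, h.numLeaves_eq]
    exact (ih o).join_left _
  | congR l h ih =>
    intro o
    exact (ih _).join_right _

theorem restrict_eq_none_inside_or_outside (A B C : BT) (a k o : ℕ) :
    (restrict (fun i => a ≤ i ∧ i < a + k) o A = none ∨
      restrict (fun i => a ≤ i ∧ i < a + k) (o + A.numLeaves) B = none ∨
      restrict (fun i => a ≤ i ∧ i < a + k) (o + A.numLeaves + B.numLeaves) C = none) ∨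
    (restrict (fun i => i ≤ a ∨ a + k ≤ i) o A = none ∨
      restrict (fun i => i ≤ a ∨ a + k ≤ i) (o + A.numLeaves) B = none ∨
      restrict (fun i => i ≤ a ∨ a + k ≤ i) (o + A.numLeaves + B.numLeaves) C = none) := by
  by_contra! h
  obtain ⟨⟨hA, -, hC⟩, -, hB, -⟩ := h
  obtain ⟨i, _, _, _, _⟩ := exists_of_restrict_ne_none _ hA
  obtain ⟨j, _, _, _⟩ := exists_of_restrict_ne_none _ hB
  obtain ⟨k, _, _, _, _⟩ := exists_of_restrict_ne_none _ hC
  omega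

/-- A rotation changes at most one of the tree induced on an interval of leaves and the tree
induced on the first leaf of the interval together with all leaves outside it. -/
theorem Rot.restrict_eq_inside_or_outside {t u : BT} (h : Rot t u) (a k : ℕ) : ∀ o,
    restrict (fun i => a ≤ i ∧ i < a + k) o t = restrict (fun i => a ≤ i ∧ i < a + k) o u ∨
    restrict (fun i => i ≤ a ∨ a + k ≤ i) o t = restrict (fun i => i ≤ a ∨ a + k ≤ i) o u := by
  induction h with
  | rotR A B C =>
    intro o
    simp only [restrict, numLeaves, ← Nat.add_assoc]
    exact (restrict_eq_none_inside_or_outside A B C a k o).imp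
      join_assoc_of_eq_none join_assoc_of_eq_none
  | rotL A B C =>
    intro o
    simp only [restrict, numLeaves, ← Nat.add_assoc]
    exact (restrict_eq_none_inside_or_outside A B C a k o).imp
      (fun h => (join_assoc_of_eq_none h).symm) (fun h => (join_assoc_of_eq_none h).symm)
  | congL r h ih =>
    intro o
    simp only [restrict, h.numLeaves_eq]
    exact (ih o).imp (fun h => by rw [h]) (fun h => by rw [h])
  | congR l h ih =>
    intro o
    simp only [restrict]
    exact (ih _).imp (fun h => by rw [h]) (fun h => by rw [h])

theorem RotOrEq.exists_rotSeq {s : BT} {y : Option BT} (h : RotOrEq (some s) y) :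
    ∃ m ≤ 1, ∃ s', y = some s' ∧ RotSeq m s s' := by
  rcases h with rfl | ⟨t, u, ht, rfl, h⟩
  · exact ⟨0, by omega, s, rfl, .refl s⟩
  · cases ht
    exact ⟨1, le_rfl, u, rfl, .step h (.refl u)⟩

theorem Rot.exists_rotSeq_restrict {t u : BT} (h : Rot t u) {a k : ℕ} {s q : BT}
    (hs : restrict (fun i => a ≤ i ∧ i < a + k) 0 t = some s)
    (hq : restrict (fun i => i ≤ a ∨ a + k ≤ i) 0 t = some q) :
    ∃ m₁ m₂ s' q', m₁ + m₂ ≤ 1 ∧ RotSeq m₁ s s' ∧ RotSeq m₂ q q' ∧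
      restrict (fun i => a ≤ i ∧ i < a + k) 0 u = some s' ∧
      restrict (fun i => i ≤ a ∨ a + k ≤ i) 0 u = some q' := by
  have h₁ := h.rotOrEq_restrict (fun i => a ≤ i ∧ i < a + k) 0
  have h₂ := h.rotOrEq_restrict (fun i => i ≤ a ∨ a + k ≤ i) 0
  rw [hs] at h₁
  rw [hq] at h₂
  rcases h.restrict_eq_inside_or_outside a k 0 with h' | h'
  · obtain ⟨m, hm, q', hq', hr⟩ := h₂.exists_rotSeq
    exact ⟨0, m, s, q', by omega, .refl s, hr, h' ▸ hs, hq'⟩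
  · obtain ⟨m, hm, s', hs', hr⟩ := h₁.exists_rotSeq
    exact ⟨m, 0, s', q, by omega, hr, .refl q, hs', h' ▸ hq⟩

theorem RotSeq.exists_rotSeq_restrict {n : ℕ} {t u : BT} (h : RotSeq n t u) {a k : ℕ} :
    ∀ {s q s' q' : BT},
    restrict (fun i => a ≤ i ∧ i < a + k) 0 t = some s →
    restrict (fun i => i ≤ a ∨ a + k ≤ i) 0 t = some q →
    restrict (fun i => a ≤ i ∧ i < a + k) 0 u = some s' →
    restrict (fun i => i ≤ a ∨ a + k ≤ i) 0 u = some q' →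
    ∃ m₁ m₂, m₁ + m₂ ≤ n ∧ RotSeq m₁ s s' ∧ RotSeq m₂ q q' := by
  induction h with
  | refl t =>
    intro s q s' q' hs hq hs' hq'
    cases hs.symm.trans hs'
    cases hq.symm.trans hq'
    exact ⟨0, 0, le_rfl, .refl s, .refl q⟩
  | step hr _ ih =>
    intro s q s' q' hs hq hs' hq'
    obtain ⟨m₁, m₂, s₁, q₁, hm, hm₁, hm₂, hs₁, hq₁⟩ := hr.exists_rotSeq_restrict hs hq
    obtain ⟨n₁, n₂, hn, hn₁, hn₂⟩ := ih hs₁ hq₁ hs' hq'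
    exact ⟨m₁ + n₁, m₂ + n₂, by omega, hm₁.trans hn₁, hm₂.trans hn₂⟩

/-- Replace the leaf of `t` at position `a`, counted from `o`, by `S`. -/
def graft (S : BT) (a : ℕ) : ℕ → BT → BT
  | o, leaf => if o = a then S else leaf
  | o, node l r => node (graft S a o l) (graft S a (o + l.numLeaves) r)

theorem Rot.graft (S : BT) (a : ℕ) {t u : BT} (h : Rot t u) :
    ∀ o, Rot (graft S a o t) (graft S a o u) := by
  induction h with
  | rotR A B C =>
    intro o
    simp only [BT.graft, numLeaves, ← Nat.add_assoc]
    exact .rotR _ _ _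
  | rotL A B C =>
    intro o
    simp only [BT.graft, numLeaves, ← Nat.add_assoc]
    exact .rotL _ _ _
  | congL r h ih =>
    intro o
    rw [BT.graft, BT.graft, h.numLeaves_eq]
    exact .congL _ (ih o)
  | congR l h ih =>
    intro o
    exact .congR _ (ih _)

theorem RotSeq.graft (S : BT) (a o : ℕ) {n : ℕ} {t u : BT} (h : RotSeq n t u) :
    RotSeq n (graft S a o t) (graft S a o u) := by
  induction h with
  | refl t => exact .refl _
  | step hr _ ih => exact .step (hr.graft S a o) ih

theorem graft_eq_self (S : BT) {a : ℕ} (t : BT) : ∀ o : ℕ,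
    a < o ∨ o + t.numLeaves ≤ a → graft S a o t = t := by
  induction t with
  | leaf =>
    intro o h
    simp only [numLeaves] at h
    rw [graft, if_neg (by omega)]
  | node l r ihl ihr =>
    intro o h
    simp only [numLeaves] at h
    rw [graft, ihl _ (by omega), ihr _ (by omega)]

theorem OccursAt.graft_replaceAt {S T : BT} {p : List Bool} (h : OccursAt S T p) (R : BT)
    {a : ℕ} : ∀ o, a = o + leavesBefore T p →
      graft R a o (replaceAt T p leaf) = replaceAt T p R := by
  induction h with
  | here T =>
    intro o ha
    simp only [leavesBefore] at ha
    rw [replaceAt, replaceAt, graft, if_pos (by omega)]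
  | @left S l p r hS ih =>
    intro o ha
    simp only [leavesBefore] at ha
    have h₁ := hS.leavesBefore_add_le
    have h₂ := hS.numLeaves_replaceAt leaf
    simp only [numLeaves] at h₂
    rw [replaceAt, replaceAt, graft, ih o ha, graft_eq_self R r _ (by omega)]
  | right l hS ih =>
    intro o ha
    simp only [leavesBefore] at ha
    rw [replaceAt, replaceAt, graft, ih _ (by omega), graft_eq_self R l _ (by omega)]

/-- (Tree form of Sleator–Tarjan–Thurston, Lemma 3b.)
If `T₁` contains a subtree `S₁` and `T₂` contains a subtree `S₂` spanning the
same interval of leaf positions, then the rotation distance decomposes as the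
sum of the distance between `S₁` and `S₂` and the distance between the trees
`Q₁`, `Q₂` obtained by replacing each `Sᵢ` by a single leaf. -/
theorem rotation_distance_decomposes
    (T₁ T₂ S₁ S₂ : BT) (p₁ p₂ : List Bool)
    (hleaves : T₁.numLeaves = T₂.numLeaves)
    (hS : S₁.numLeaves = S₂.numLeaves)
    (h₁ : OccursAt S₁ T₁ p₁) (h₂ : OccursAt S₂ T₂ p₂)
    (hpos : leavesBefore T₁ p₁ = leavesBefore T₂ p₂) :
    rotDist T₁ T₂ =
      rotDist S₁ S₂ + rotDist (replaceAt T₁ p₁ leaf) (replaceAt T₂ p₂ leaf) := by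
  have hQ : (replaceAt T₁ p₁ leaf).numLeaves = (replaceAt T₂ p₂ leaf).numLeaves := by
    have := h₁.numLeaves_replaceAt leaf
    have := h₂.numLeaves_replaceAt leaf
    omega
  apply le_antisymm
  · have hs := h₁.rotSeq_replaceAt (rotSeq_rotDist hS)
    have hq := (rotSeq_rotDist hQ).graft S₂ (leavesBefore T₁ p₁) 0
    rw [h₁.graft_replaceAt S₂ 0 (by omega), h₂.graft_replaceAt S₂ 0 (by omega),
      h₂.replaceAt_self] at hq
    rw [h₁.replaceAt_self] at hs
    exact (hs.trans hq).rotDist_le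
  · have hs := h₂.restrict_inside (a := leavesBefore T₁ p₁) 0 (by omega)
    have hq := h₂.restrict_outside (a := leavesBefore T₁ p₁) 0 (by omega)
    simp only [← hS] at hs hq
    obtain ⟨m₁, m₂, hm, hm₁, hm₂⟩ := (rotSeq_rotDist hleaves).exists_rotSeq_restrict
      (h₁.restrict_inside 0 (by omega)) (h₁.restrict_outside 0 (by omega)) hs hq
    exact (Nat.add_le_add hm₁.rotDist_le hm₂.rotDist_le).trans hm

end BT
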